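/- Let M ≥ 1 be a natural number and p ∈ (0,1)^M. Then, as the real degrees-of-freedom parameter κ → 0⁺, the chi-squared quantile pooled p-value converges to Tippett's pooled p-value: lim_{κ→0⁺} [ 1 − F_χ( ∑_{i=1}^M F_χ⁻¹(1 − p_i; κ); Mκ ) ] = 1 − (1 − min_i p_i)^M. -/

import Mathlib

open Set Filter Topology

/-- `F_χ(·;κ)`: the CDF of the chi-squared distribution with real degrees of
freedom `κ`, i.e. of the Gamma distribution with shape `κ/2` and rate `1/2`. -/
noncomputable def chiSqCDF (κ : ℝ) : ℝ → ℝ :=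
  fun x => ProbabilityTheory.cdf (ProbabilityTheory.gammaMeasure (κ / 2) (1 / 2)) x

/-- `F_χ⁻¹(q;κ)`: the quantile function of the chi-squared distribution. -/
noncomputable def chiSqInv (κ : ℝ) (q : ℝ) : ℝ := sInf {x : ℝ | q ≤ chiSqCDF κ x}

open ProbabilityTheory MeasureTheory in
lemma cdf_gammaMeasure_eq_intervalIntegral {a r x : ℝ} (ha : 0 < a) (hr : 0 < r) (hx : 0 ≤ x) :
    cdf (gammaMeasure a r) x =
      r ^ a / Real.Gamma a * ∫ t in (0 : ℝ)..x, t ^ (a - 1) * Real.exp (-(r * t)) := by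
  rw [cdf_gammaMeasure_eq_integral ha hr,
    setIntegral_eq_of_subset_of_forall_sdiff_eq_zero measurableSet_Iic
      (Icc_subset_Iic_self : Icc 0 x ⊆ Iic x) ?_,
    integral_Icc_eq_integral_Ioc, ← intervalIntegral.integral_of_le hx,
    ← intervalIntegral.integral_const_mul]
  · refine intervalIntegral.integral_congr fun t ht => ?_
    rw [uIcc_of_le hx] at ht
    simp [gammaPDFReal, ht.1, mul_assoc]
  · rintro t ⟨ht, ht'⟩
    have : ¬ 0 ≤ t := fun h => ht' ⟨h, ht⟩
    simp [gammaPDFReal, this]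

lemma gamma_normalization_mul_rpow_div {a r x : ℝ} (ha : 0 < a) (hr : 0 < r) (hx : 0 ≤ x) :
    r ^ a / Real.Gamma a * (x ^ a / a) = (r * x) ^ a / Real.Gamma (a + 1) := by
  have := (Real.Gamma_pos_of_pos ha).ne'
  rw [Real.Gamma_add_one ha.ne', Real.mul_rpow hr.le hx]
  field_simp

lemma integral_rpow_sub_one {a : ℝ} (ha : 0 < a) (x : ℝ) :
    ∫ t in (0 : ℝ)..x, t ^ (a - 1) = x ^ a / a := by
  rw [integral_rpow (Or.inl (by linarith))]
  simp [Real.zero_rpow ha.ne']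

lemma intervalIntegrable_rpow_sub_one_mul_exp {a : ℝ} (ha : 0 < a) (r x : ℝ) :
    IntervalIntegrable (fun t : ℝ => t ^ (a - 1) * Real.exp (-(r * t)))
      MeasureTheory.volume 0 x :=
  (intervalIntegral.intervalIntegrable_rpow' (by linarith)).mul_continuousOn (by fun_prop)

open ProbabilityTheory in
lemma cdf_gammaMeasure_le {a r x : ℝ} (ha : 0 < a) (hr : 0 < r) (hx : 0 ≤ x) :
    cdf (gammaMeasure a r) x ≤ (r * x) ^ a / Real.Gamma (a + 1) := by
  have := Real.Gamma_pos_of_pos ha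
  rw [cdf_gammaMeasure_eq_intervalIntegral ha hr hx, ← gamma_normalization_mul_rpow_div ha hr hx,
    ← integral_rpow_sub_one ha]
  gcongr
  refine intervalIntegral.integral_mono_on hx (intervalIntegrable_rpow_sub_one_mul_exp ha r x)
    (intervalIntegral.intervalIntegrable_rpow' (by linarith)) fun t ht => ?_
  have h := mul_nonneg hr.le ht.1
  exact mul_le_of_le_one_right (Real.rpow_nonneg ht.1 _) (Real.exp_le_one_iff.2 (by linarith))

open ProbabilityTheory in
lemma le_cdf_gammaMeasure {a r x : ℝ} (ha : 0 < a) (hr : 0 < r) (hx : 0 ≤ x) :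
    (r * x) ^ a / Real.Gamma (a + 1) * Real.exp (-(r * x)) ≤ cdf (gammaMeasure a r) x := by
  have := Real.Gamma_pos_of_pos ha
  rw [cdf_gammaMeasure_eq_intervalIntegral ha hr hx, ← gamma_normalization_mul_rpow_div ha hr hx,
    ← integral_rpow_sub_one ha, mul_assoc, ← intervalIntegral.integral_mul_const]
  gcongr
  refine intervalIntegral.integral_mono_on hx
    ((intervalIntegral.intervalIntegrable_rpow' (by linarith)).mul_const _)
    (intervalIntegrable_rpow_sub_one_mul_exp ha r x) fun t ht => ?_
  have := Real.rpow_nonneg ht.1 (a - 1)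
  have := ht.2
  gcongr

lemma monotone_chiSqCDF (κ : ℝ) : Monotone (chiSqCDF κ) :=
  ProbabilityTheory.monotone_cdf _

lemma chiSqCDF_of_nonpos {κ x : ℝ} (hκ : 0 < κ) (hx : x ≤ 0) : chiSqCDF κ x = 0 := by
  refine le_antisymm ((monotone_chiSqCDF κ hx).trans ?_) (ProbabilityTheory.cdf_nonneg _ _)
  refine (cdf_gammaMeasure_le (half_pos hκ) one_half_pos le_rfl).trans ?_
  simp [Real.zero_rpow (half_pos hκ).ne']

lemma nonneg_of_le_chiSqCDF {κ q x : ℝ} (hκ : 0 < κ) (hq : 0 < q) (h : q ≤ chiSqCDF κ x) :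
    0 ≤ x := by
  by_contra! hx
  linarith [chiSqCDF_of_nonpos hκ hx.le]

lemma chiSqInv_nonneg {κ q : ℝ} (hκ : 0 < κ) (hq : 0 < q) : 0 ≤ chiSqInv κ q :=
  Real.sInf_nonneg fun _ hx => nonneg_of_le_chiSqCDF hκ hq hx

lemma chiSqInv_le {κ q x : ℝ} (hκ : 0 < κ) (hq : 0 < q) (h : q ≤ chiSqCDF κ x) :
    chiSqInv κ q ≤ x :=
  csInf_le ⟨0, fun _ hy => nonneg_of_le_chiSqCDF hκ hq hy⟩ h

lemma le_chiSqInv {κ q x : ℝ} (hq : q < 1) (h : chiSqCDF κ x < q) : x ≤ chiSqInv κ q := by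
  obtain ⟨y, hy⟩ := ((ProbabilityTheory.tendsto_cdf_atTop
    (ProbabilityTheory.gammaMeasure (κ / 2) (1 / 2))).eventually_const_le hq).exists
  exact le_csInf ⟨y, hy⟩ fun z hz => ((monotone_chiSqCDF κ).reflect_lt (h.trans_le hz)).le

/-- A chi-squared variable of degrees of freedom `κ` lives at the scale `c ^ (2 / κ)` as `κ → 0⁺`,
and constant factors are negligible at this scale. -/
lemma tendsto_chiSqCDF_const_mul_rpow {n : ℕ} (hn : 1 ≤ n) {K c : ℝ} (hK : 0 < K)
    (hc : c ∈ Ioo (0 : ℝ) 1) :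
    Tendsto (fun κ : ℝ => chiSqCDF (n * κ) (K * c ^ (2 / κ))) (𝓝[>] 0) (𝓝 (c ^ n)) := by
  have hn0 : (0 : ℝ) < n := by exact_mod_cast hn
  have hc0 := hc.1
  have hid : Tendsto (fun κ : ℝ => n * κ / 2) (𝓝[>] 0) (𝓝 0) := by
    have : ContinuousAt (fun κ : ℝ => n * κ / 2) 0 := by fun_prop
    simpa using this.tendsto.mono_left nhdsWithin_le_nhds
  have hscale : Tendsto (fun κ : ℝ => c ^ (2 / κ)) (𝓝[>] 0) (𝓝 0) := by
    refine (tendsto_rpow_atTop_of_base_lt_one c (by linarith) hc.2).comp ?_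
    exact tendsto_inv_nhdsGT_zero.const_mul_atTop (zero_lt_two' ℝ)
  have hGamma : Tendsto (fun κ : ℝ => Real.Gamma (n * κ / 2 + 1)) (𝓝[>] 0) (𝓝 1) := by
    have h : ContinuousAt Real.Gamma 1 :=
      (Real.differentiableAt_Gamma fun m => by
      have := m.cast_nonneg (α := ℝ)
      linarith).continuousAt
    rw [← Real.Gamma_one]
    exact h.tendsto.comp (by simpa using hid.add_const 1)
  have hconst : Tendsto (fun κ : ℝ => (1 / 2 * K) ^ (n * κ / 2)) (𝓝[>] 0) (𝓝 1) := by
    have h : ContinuousAt (fun y : ℝ => (1 / 2 * K) ^ y) 0 :=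
      Real.continuousAt_const_rpow (by positivity)
    simpa only [Real.rpow_zero, Function.comp_def] using h.tendsto.comp hid
  have hupper : Tendsto (fun κ : ℝ => (1 / 2 * K) ^ (n * κ / 2) * c ^ n /
      Real.Gamma (n * κ / 2 + 1)) (𝓝[>] 0) (𝓝 (c ^ n)) := by
    simpa only [one_mul, div_one, Pi.div_def] using (hconst.mul_const (c ^ n)).div hGamma one_ne_zero
  have hexp : Tendsto (fun κ : ℝ => Real.exp (-(1 / 2 * (K * c ^ (2 / κ))))) (𝓝[>] 0) (𝓝 1) := by
    simpa only [mul_zero, neg_zero, Real.exp_zero] using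
      (((hscale.const_mul K).const_mul (1 / 2)).neg).rexp
  have hpow : ∀ κ : ℝ, 0 < κ → (1 / 2 * (K * c ^ (2 / κ))) ^ (n * κ / 2) =
      (1 / 2 * K) ^ (n * κ / 2) * c ^ n := by
    intro κ hκ
    rw [← mul_assoc, Real.mul_rpow (by positivity) (by positivity), ← Real.rpow_mul hc0.le,
      show 2 / κ * (n * κ / 2) = n by field_simp, Real.rpow_natCast]
  refine tendsto_of_tendsto_of_tendsto_of_le_of_le' (by simpa only [mul_one] using hupper.mul hexp)
    hupper ?_ ?_
  · filter_upwards [self_mem_nhdsWithin] with κ (hκ : 0 < κ)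
    rw [← hpow κ hκ]
    exact le_cdf_gammaMeasure (by positivity) one_half_pos (by positivity)
  · filter_upwards [self_mem_nhdsWithin] with κ (hκ : 0 < κ)
    rw [← hpow κ hκ]
    exact cdf_gammaMeasure_le (by positivity) one_half_pos (by positivity)

lemma tendsto_chiSqCDF_rpow {c : ℝ} (hc : c ∈ Ioo (0 : ℝ) 1) :
    Tendsto (fun κ : ℝ => chiSqCDF κ (c ^ (2 / κ))) (𝓝[>] 0) (𝓝 c) := by
  simpa using tendsto_chiSqCDF_const_mul_rpow le_rfl one_pos hc

lemma eventually_rpow_le_chiSqInv {c q : ℝ} (hc : 0 < c) (hcq : c < q) (hq : q < 1) :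
    ∀ᶠ κ : ℝ in 𝓝[>] 0, c ^ (2 / κ) ≤ chiSqInv κ q := by
  filter_upwards [(tendsto_chiSqCDF_rpow ⟨hc, hcq.trans hq⟩).eventually_lt_const hcq] with κ h
  exact le_chiSqInv hq h

lemma eventually_chiSqInv_le_rpow {d q : ℝ} (hq : 0 < q) (hqd : q < d) (hd : d < 1) :
    ∀ᶠ κ : ℝ in 𝓝[>] 0, chiSqInv κ q ≤ d ^ (2 / κ) := by
  filter_upwards [(tendsto_chiSqCDF_rpow ⟨hq.trans hqd, hd⟩).eventually_const_lt hqd,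
    self_mem_nhdsWithin] with κ h hκ
  exact chiSqInv_le hκ hq h.le

/-- For `M ≥ 1` and `p ∈ (0,1)^M`, as `κ → 0⁺` the chi-squared
quantile pooled p-value converges to Tippett's pooled p-value:
`1 − F_χ(∑ i, F_χ⁻¹(1 − p_i; κ); Mκ) → 1 − (1 − min_i p_i)^M`. -/
theorem chiPool_tendsto_tippett
    (M : ℕ) (hM : 1 ≤ M) (p : Fin M → ℝ) (hp : ∀ i, p i ∈ Set.Ioo (0 : ℝ) 1) :
    Tendsto (fun κ : ℝ =>
        1 - chiSqCDF ((M : ℝ) * κ) (∑ i : Fin M, chiSqInv κ (1 - p i)))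
      (nhdsWithin 0 (Set.Ioi 0))
      (nhds (1 - (1 - ⨅ i, p i) ^ M)) := by
  have : Nonempty (Fin M) := ⟨⟨0, hM⟩⟩
  have hM0 : (0 : ℝ) < M := by exact_mod_cast hM
  obtain ⟨j, hj⟩ := exists_eq_ciInf_of_finite (f := p)
  have hmin : ∀ i, p j ≤ p i := fun i => hj ▸ ciInf_le (finite_range p).bddBelow i
  rw [← hj]
  have hpj := hp j
  have hcont : ContinuousAt (fun c : ℝ => c ^ M) (1 - p j) := by fun_prop
  refine Tendsto.const_sub 1 (tendsto_order.2 ⟨fun u hu => ?_, fun u hu => ?_⟩)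
  · obtain ⟨c, ⟨hcu, hc0⟩, hc⟩ := (((hcont.eventually (lt_mem_nhds hu)).and
      (lt_mem_nhds (sub_pos.2 hpj.2))).filter_mono nhdsWithin_le_nhds |>.and
      (self_mem_nhdsWithin (s := Iio (1 - p j)))).exists
    have hc : c < 1 - p j := hc
    have hlim := tendsto_chiSqCDF_const_mul_rpow hM one_pos ⟨hc0, by linarith [hpj.1]⟩
    filter_upwards [hlim.eventually_const_lt hcu,
      eventually_rpow_le_chiSqInv hc0 hc (by linarith [hpj.1]),
      self_mem_nhdsWithin] with κ hκu hκ hκ0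
    refine hκu.trans_le (monotone_chiSqCDF _ ?_)
    rw [one_mul]
    exact hκ.trans (Finset.single_le_sum (f := fun i => chiSqInv κ (1 - p i))
      (fun i _ => chiSqInv_nonneg hκ0 (sub_pos.2 (hp i).2)) (Finset.mem_univ j))
  · obtain ⟨d, ⟨hdu, hd1⟩, hd⟩ := (((hcont.eventually (gt_mem_nhds hu)).and
      (gt_mem_nhds (sub_lt_self 1 hpj.1))).filter_mono nhdsWithin_le_nhds |>.and
      (self_mem_nhdsWithin (s := Ioi (1 - p j)))).exists
    have hd : 1 - p j < d := hd
    have hlim := tendsto_chiSqCDF_const_mul_rpow hM hM0 ⟨by linarith [hpj.2], hd1⟩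
    have hle : ∀ᶠ κ : ℝ in 𝓝[>] 0, ∀ i, chiSqInv κ (1 - p i) ≤ d ^ (2 / κ) :=
      eventually_all.2 fun i => eventually_chiSqInv_le_rpow (sub_pos.2 (hp i).2)
        (by linarith [hmin i]) hd1
    filter_upwards [hlim.eventually_lt_const hdu, hle] with κ hκu hκ
    refine (monotone_chiSqCDF _ ?_).trans_lt hκu
    simpa using Finset.sum_le_sum fun i (_ : i ∈ Finset.univ) => hκ i
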